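/- arXiv:2002.11976 — 4 statements merged into one kernel-verified Lean document; each statement's English description precedes it below -/
import Mathlib

section
/- Let a, b, σ : ℝ → ℝ be continuous, fix T ∈ ℝ, set κ(t) = ∫_0^t b(s) ds, Γ(t) = ∫_t^T exp(κ(t) − κ(s)) ds, Λ(t) = ∫_t^T ( a(v)·Γ(v) − (1/2)·σ(v)²·Γ(v)² ) dv, and define V(r,t) = exp(−r·Γ(t) − Λ(t)). Then V satisfies the Hull-White partial differential equation ∂V/∂t (r,t) + (a(t) − b(t)·r)·∂V/∂r (r,t) + (1/2)·σ(t)²·∂²V/∂r² (r,t) − r·V(r,t) = 0 for all r, t ∈ ℝ, together with the terminal condition V(r,T) = 1 for all r. -/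
/-- The derivative of an integral of a continuous function with respect to its lower limit. -/
theorem hasDerivAt_integral_lower {f : ℝ → ℝ} (hf : Continuous f) (T t : ℝ) :
    HasDerivAt (fun t => ∫ s in t..T, f s) (-f t) t :=
  intervalIntegral.integral_hasDerivAt_left (hf.intervalIntegrable _ _)
    hf.stronglyMeasurable.stronglyMeasurableAtFilter hf.continuousAt

/-- The closed-form zero-coupon bond price `V(r,t) = exp(−rΓ(t) − Λ(t))` satisfies the
Hull-White PDE `∂V/∂t + (a(t) − b(t)r)∂V/∂r + (1/2)σ(t)²∂²V/∂r² − rV = 0` together with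
the terminal condition `V(r,T) = 1`. -/
theorem hull_white_pde_solution
    (a b σ : ℝ → ℝ) (ha : Continuous a) (hb : Continuous b) (hσ : Continuous σ)
    (T : ℝ) (κ Γ Λ : ℝ → ℝ)
    (hκ : ∀ t, κ t = ∫ s in (0:ℝ)..t, b s)
    (hΓ : ∀ t, Γ t = ∫ s in t..T, Real.exp (κ t - κ s))
    (hΛ : ∀ t, Λ t = ∫ v in t..T, (a v * Γ v - (1/2) * σ v ^ 2 * Γ v ^ 2))
    (V : ℝ → ℝ → ℝ)
    (hV : ∀ r t, V r t = Real.exp (-r * Γ t - Λ t)) :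
    (∀ r t, deriv (fun t' => V r t') t
        + (a t - b t * r) * deriv (fun r' => V r' t) r
        + (1/2) * σ t ^ 2 * deriv (deriv (fun r' => V r' t)) r
        - r * V r t = 0)
      ∧ ∀ r, V r T = 1 := by
  have hκ' (t : ℝ) : HasDerivAt κ (b t) t := by
    rw [funext hκ]
    exact intervalIntegral.integral_hasDerivAt_right (hb.intervalIntegrable _ _)
      hb.stronglyMeasurable.stronglyMeasurableAtFilter hb.continuousAt
  have hκc : Continuous κ := continuous_iff_continuousAt.2 fun t => (hκ' t).continuousAt
  have hΓ_eq : Γ = fun t => Real.exp (κ t) * ∫ s in t..T, Real.exp (-κ s) := by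
    funext t
    simp only [hΓ, sub_eq_add_neg, Real.exp_add, intervalIntegral.integral_const_mul]
  have hΓ' (t : ℝ) : HasDerivAt Γ (b t * Γ t - 1) t := by
    have h := (hκ' t).exp.mul
      (hasDerivAt_integral_lower (f := fun s => Real.exp (-κ s)) (by fun_prop) T t)
    have hexp : Real.exp (κ t) * Real.exp (-κ t) = 1 := by
      rw [← Real.exp_add, add_neg_cancel, Real.exp_zero]
    rw [hΓ_eq]
    refine h.congr_deriv ?_
    linear_combination -hexp
  have hΓc : Continuous Γ := continuous_iff_continuousAt.2 fun t => (hΓ' t).continuousAt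
  have hΛ' (t : ℝ) : HasDerivAt Λ (-(a t * Γ t - (1/2) * σ t ^ 2 * Γ t ^ 2)) t := by
    rw [funext hΛ]
    exact hasDerivAt_integral_lower
      (f := fun v => a v * Γ v - (1/2) * σ v ^ 2 * Γ v ^ 2) (by fun_prop) T t
  have hVt (r t : ℝ) : HasDerivAt (fun t' => V r t')
      (V r t * (-r * (b t * Γ t - 1) - -(a t * Γ t - (1/2) * σ t ^ 2 * Γ t ^ 2))) t := by
    simp only [hV]
    exact (((hΓ' t).const_mul (-r)).sub (hΛ' t)).exp
  have hVr (r t : ℝ) : HasDerivAt (fun r' => V r' t) (V r t * -Γ t) r := by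
    simp only [hV]
    refine ((((hasDerivAt_id r).neg.mul_const (Γ t)).sub_const (Λ t)).exp).congr_deriv ?_
    simp
  refine ⟨fun r t => ?_, fun r => by simp [hV, hΓ, hΛ]⟩
  have hVr_eq : deriv (fun r' => V r' t) = fun r' => V r' t * -Γ t :=
    funext fun r' => (hVr r' t).deriv
  rw [(hVt r t).deriv, hVr_eq, ((hVr r t).mul_const (-Γ t)).deriv]
  ring
end

section
/- Let a, b, σ : ℝ → ℝ be continuous, κ(t) = ∫_0^t b(s) ds, and Λ₀(T) = ∫_0^T [ e^{κ(v)} a(v) (∫_v^T e^{−κ(z)} dz) − (1/2) e^{2κ(v)} σ(v)² (∫_v^T e^{−κ(z)} dz)² ] dv. Then Λ₀ is differentiable and for every T: e^{κ(T)} · Λ₀'(T) = ∫_0^T [ e^{κ(v)} a(v) − e^{2κ(v)} σ(v)² (∫_v^T e^{−κ(z)} dz) ] dv. -/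
open intervalIntegral in
/-- Differentiation of a quadratic expression in `E T - E v` integrated over `v ∈ [c, T]`: the
integrand vanishes at `v = T`, so only the dependence on `E T` contributes. -/
theorem hasDerivAt_integral_sub_sub_half_sq {f g E : ℝ → ℝ} (hf : Continuous f)
    (hg : Continuous g) (hE : Continuous E) {e T : ℝ} (hET : HasDerivAt E e T) (c : ℝ) :
    HasDerivAt
      (fun T => ∫ v in c..T, (f v * (E T - E v) - (1 / 2) * g v * (E T - E v) ^ 2))
      (e * ∫ v in c..T, (f v - g v * (E T - E v))) T := by
  have key : ∀ {h : ℝ → ℝ}, Continuous h →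
      HasDerivAt (fun T => ∫ v in c..T, h v) (h T) T := fun hh =>
    integral_hasDerivAt_right (hh.intervalIntegrable _ _)
      hh.aestronglyMeasurable.stronglyMeasurableAtFilter hh.continuousAt
  have hfE : Continuous fun v => f v * E v := by fun_prop
  have hgE : Continuous fun v => g v * E v := by fun_prop
  have hgE2 : Continuous fun v => g v * E v ^ 2 := by fun_prop
  have expand : ∀ S, (∫ v in c..S, (f v * (E S - E v) - (1 / 2) * g v * (E S - E v) ^ 2)) =
      E S * (∫ v in c..S, f v) - (∫ v in c..S, f v * E v)
        - (1 / 2) * (E S ^ 2 * (∫ v in c..S, g v) - 2 * (E S * ∫ v in c..S, g v * E v)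
          + ∫ v in c..S, g v * E v ^ 2) := by
    intro S
    simp only [← integral_const_mul]
    rw [← integral_sub, ← integral_sub, ← integral_add, ← integral_const_mul, ← integral_sub]
    · exact integral_congr fun v _ => by ring
    all_goals exact Continuous.intervalIntegrable (by fun_prop) _ _
  have expand' : (∫ v in c..T, (f v - g v * (E T - E v))) =
      (∫ v in c..T, f v) - (E T * (∫ v in c..T, g v) - ∫ v in c..T, g v * E v) := by
    rw [← integral_const_mul, ← integral_sub, ← integral_sub]
    · exact integral_congr fun v _ => by ring
    all_goals exact Continuous.intervalIntegrable (by fun_prop) _ _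
  rw [funext expand, expand']
  refine (((hET.mul (key hf)).sub (key hfE)).sub
    ((((hET.pow 2).mul (key hg)).sub ((hET.mul (key hgE)).const_mul 2)).add
      (key hgE2) |>.const_mul (1 / 2))).congr_deriv ?_
  simp only [Pi.pow_apply]
  push_cast
  ring


/-- First derivative identity in the Hull-White calibration:
`e^{κ(T)} Λ₀'(T) = ∫_0^T [ e^{κ(v)} a(v) − e^{2κ(v)} σ(v)² (∫_v^T e^{−κ(z)} dz) ] dv`. -/
theorem hull_white_calibration_first_derivative
    (a b σ : ℝ → ℝ) (ha : Continuous a) (hb : Continuous b) (hσ : Continuous σ)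
    (κ Λ₀ : ℝ → ℝ)
    (hκ : ∀ t, κ t = ∫ s in (0:ℝ)..t, b s)
    (hΛ : ∀ T, Λ₀ T = ∫ v in (0:ℝ)..T,
      (Real.exp (κ v) * a v * (∫ z in v..T, Real.exp (-κ z))
        - (1/2) * Real.exp (2 * κ v) * σ v ^ 2 * (∫ z in v..T, Real.exp (-κ z)) ^ 2)) :
    Differentiable ℝ Λ₀
      ∧ ∀ T, Real.exp (κ T) * deriv Λ₀ T
        = ∫ v in (0:ℝ)..T,
            (Real.exp (κ v) * a v
              - Real.exp (2 * κ v) * σ v ^ 2 * (∫ z in v..T, Real.exp (-κ z))) := by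
  have hκc : Continuous κ := by
    rw [funext hκ]
    exact intervalIntegral.continuous_primitive (fun _ _ => hb.intervalIntegrable _ _) 0
  have hexp : Continuous fun z => Real.exp (-κ z) := by fun_prop
  have hint : ∀ u w, IntervalIntegrable (fun z => Real.exp (-κ z)) MeasureTheory.volume u w :=
    fun _ _ => hexp.intervalIntegrable _ _
  obtain ⟨E, hE⟩ : ∃ E : ℝ → ℝ, ∀ x, E x = ∫ z in (0:ℝ)..x, Real.exp (-κ z) := ⟨_, fun _ => rfl⟩
  have hEd : ∀ x, HasDerivAt E (Real.exp (-κ x)) x := by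
    intro x
    rw [funext hE]
    exact intervalIntegral.integral_hasDerivAt_right (hint 0 x)
      hexp.aestronglyMeasurable.stronglyMeasurableAtFilter hexp.continuousAt
  have hEc : Continuous E := continuous_iff_continuousAt.2 fun x => (hEd x).continuousAt
  have hsplit : ∀ v T, (∫ z in v..T, Real.exp (-κ z)) = E T - E v := fun v T => by
    rw [hE, hE, intervalIntegral.integral_interval_sub_left (hint 0 T) (hint 0 v)]
  have hderiv : ∀ T, HasDerivAt Λ₀ (Real.exp (-κ T) * ∫ v in (0:ℝ)..T,
      (Real.exp (κ v) * a v
        - Real.exp (2 * κ v) * σ v ^ 2 * (∫ z in v..T, Real.exp (-κ z)))) T := by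
    intro T
    rw [funext hΛ]
    simp only [hsplit, mul_assoc (1 / 2 : ℝ) (Real.exp _)]
    exact hasDerivAt_integral_sub_sub_half_sq
      (f := fun v => Real.exp (κ v) * a v) (g := fun v => Real.exp (2 * κ v) * σ v ^ 2)
      (by fun_prop) (by fun_prop) hEc (hEd T) 0
  refine ⟨fun T => (hderiv T).differentiableAt, fun T => ?_⟩
  rw [(hderiv T).deriv, ← mul_assoc, ← Real.exp_add, add_neg_cancel, Real.exp_zero, one_mul]
end

section
/- Let a, b, σ : ℝ → ℝ be continuous, κ(t) = ∫_0^t b(s) ds, and Λ₀(T) = ∫_0^T [ e^{κ(v)} a(v) (∫_v^T e^{−κ(z)} dz) − (1/2) e^{2κ(v)} σ(v)² (∫_v^T e^{−κ(z)} dz)² ] dv. Then the function T ↦ e^{κ(T)} Λ₀'(T) is differentiable and for every T: e^{κ(T)} · d/dT [ e^{κ(T)} Λ₀'(T) ] = e^{2κ(T)} a(T) − ∫_0^T e^{2κ(v)} σ(v)² dv. -/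
open intervalIntegral in
/-- Moment expansion of an integral against a linear and a quadratic increment of `G`. -/
theorem integral_mul_sub_sub_half_mul_sub_sq {p q G : ℝ → ℝ}
    (hp : Continuous p) (hq : Continuous q) (hG : Continuous G) (x y c : ℝ) :
    ∫ v in x..y, (p v * (c - G v) - (1/2) * q v * (c - G v) ^ 2)
      = c * (∫ v in x..y, p v) - (∫ v in x..y, p v * G v)
        - (1/2) * c ^ 2 * (∫ v in x..y, q v) + c * (∫ v in x..y, q v * G v)
        - (1/2) * ∫ v in x..y, q v * G v ^ 2 := by
  have integrable {f : ℝ → ℝ} (hf : Continuous f) :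
      IntervalIntegrable f MeasureTheory.volume x y := hf.intervalIntegrable x y
  simp only [← integral_const_mul]
  rw [← integral_sub (integrable (by fun_prop)) (integrable (by fun_prop)),
    ← integral_sub (integrable (by fun_prop)) (integrable (by fun_prop)),
    ← integral_add (integrable (by fun_prop)) (integrable (by fun_prop)),
    ← integral_sub (integrable (by fun_prop)) (integrable (by fun_prop))]
  refine integral_congr fun v _ => ?_
  ring

/-- Leibniz rule for the moving-endpoint integral of `p * ΔG - q * ΔG ^ 2 / 2`,
where `ΔG = G T - G v`. -/
theorem hasDerivAt_integral_mul_sub_sub_half_mul_sub_sq {p q g G : ℝ → ℝ}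
    (hp : Continuous p) (hq : Continuous q) (hG : ∀ t, HasDerivAt G (g t) t) (x T : ℝ) :
    HasDerivAt (fun t => ∫ v in x..t, (p v * (G t - G v) - (1/2) * q v * (G t - G v) ^ 2))
      (g T * ((∫ v in x..T, p v) - G T * (∫ v in x..T, q v) + ∫ v in x..T, q v * G v)) T := by
  have hGc : Continuous G := continuous_iff_continuousAt.2 fun t => (hG t).continuousAt
  have primitive {f : ℝ → ℝ} (hf : Continuous f) :
      HasDerivAt (fun t => ∫ v in x..t, f v) (f T) T :=
    (hf.integral_hasStrictDerivAt x T).hasDerivAt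
  simp only [integral_mul_sub_sub_half_mul_sub_sq hp hq hGc]
  have hexp := (((((hG T).mul (primitive hp)).sub (primitive (hp.mul hGc))).sub
    ((((hG T).pow 2).const_mul (1/2)).mul (primitive hq))).add
    ((hG T).mul (primitive (hq.mul hGc)))).sub
    ((primitive (hq.mul (hGc.pow 2))).const_mul (1/2))
  refine hexp.congr_deriv ?_
  simp only [Pi.mul_apply, Pi.pow_apply]
  ring

/-- Second derivative identity in the Hull-White calibration:
`e^{κ(T)} d/dT [ e^{κ(T)} Λ₀'(T) ] = e^{2κ(T)} a(T) − ∫_0^T e^{2κ(v)} σ(v)² dv`. -/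
theorem hull_white_calibration_second_derivative
    (a b σ : ℝ → ℝ) (ha : Continuous a) (hb : Continuous b) (hσ : Continuous σ)
    (κ Λ₀ : ℝ → ℝ)
    (hκ : ∀ t, κ t = ∫ s in (0:ℝ)..t, b s)
    (hΛ : ∀ T, Λ₀ T = ∫ v in (0:ℝ)..T,
      (Real.exp (κ v) * a v * (∫ z in v..T, Real.exp (-κ z))
        - (1/2) * Real.exp (2 * κ v) * σ v ^ 2 * (∫ z in v..T, Real.exp (-κ z)) ^ 2)) :
    Differentiable ℝ (fun T => Real.exp (κ T) * deriv Λ₀ T)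
      ∧ ∀ T, Real.exp (κ T) * deriv (fun T' => Real.exp (κ T') * deriv Λ₀ T') T
        = Real.exp (2 * κ T) * a T - ∫ v in (0:ℝ)..T, Real.exp (2 * κ v) * σ v ^ 2 := by
  have hκc : Continuous κ := by
    rw [funext hκ]
    exact intervalIntegral.continuous_primitive (fun _ _ => hb.intervalIntegrable _ _) 0
  have hE : Continuous fun z => Real.exp (-κ z) := by fun_prop
  set p : ℝ → ℝ := fun v => Real.exp (κ v) * a v with hp_def
  set q : ℝ → ℝ := fun v => Real.exp (2 * κ v) * σ v ^ 2 with hq_def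
  set G : ℝ → ℝ := fun t => ∫ z in (0:ℝ)..t, Real.exp (-κ z)
  have hp : Continuous p := by fun_prop
  have hq : Continuous q := by fun_prop
  have primitive {f : ℝ → ℝ} (hf : Continuous f) (T : ℝ) :
      HasDerivAt (fun t => ∫ v in (0:ℝ)..t, f v) (f T) T :=
    (hf.integral_hasStrictDerivAt 0 T).hasDerivAt
  have hG (t : ℝ) : HasDerivAt G (Real.exp (-κ t)) t := primitive hE t
  have hGc : Continuous G := continuous_iff_continuousAt.2 fun t => (hG t).continuousAt
  have increment (v T : ℝ) : ∫ z in v..T, Real.exp (-κ z) = G T - G v :=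
    (intervalIntegral.integral_interval_sub_left (hE.intervalIntegrable _ _)
      (hE.intervalIntegrable _ _)).symm
  have hΛ_eq : Λ₀ = fun T => ∫ v in (0:ℝ)..T,
      (p v * (G T - G v) - (1/2) * q v * (G T - G v) ^ 2) := by
    funext T
    simp only [hΛ, increment, hp_def, hq_def, mul_assoc]
  have hderiv : (fun T => Real.exp (κ T) * deriv Λ₀ T) = fun T =>
      (∫ v in (0:ℝ)..T, p v) - G T * (∫ v in (0:ℝ)..T, q v) + ∫ v in (0:ℝ)..T, q v * G v := by
    funext T
    rw [hΛ_eq, (hasDerivAt_integral_mul_sub_sub_half_mul_sub_sq hp hq hG 0 T).deriv, ← mul_assoc,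
      ← Real.exp_add, add_neg_cancel, Real.exp_zero, one_mul]
  have hsecond (T : ℝ) : HasDerivAt (fun T => Real.exp (κ T) * deriv Λ₀ T)
      (p T - Real.exp (-κ T) * ∫ v in (0:ℝ)..T, q v) T := by
    rw [hderiv]
    have hsum := ((primitive hp T).sub ((hG T).mul (primitive hq T))).add
      (primitive (hq.mul hGc) T)
    refine hsum.congr_deriv ?_
    simp only [Pi.mul_apply]
    ring
  refine ⟨fun T => (hsecond T).differentiableAt, fun T => ?_⟩
  rw [(hsecond T).deriv, mul_sub, ← mul_assoc, ← mul_assoc, ← Real.exp_add, ← Real.exp_add,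
    add_neg_cancel, Real.exp_zero, one_mul, two_mul]
end

section
/- Let b, σ : ℝ → ℝ be continuous, let a : ℝ → ℝ be continuously differentiable, set κ(t) = ∫_0^t b(s) ds and Λ₀(T) = ∫_0^T [ e^{κ(v)} a(v) (∫_v^T e^{−κ(z)} dz) − (1/2) e^{2κ(v)} σ(v)² (∫_v^T e^{−κ(z)} dz)² ] dv. Then for every T: d/dT [ e^{κ(T)} · d/dT ( e^{κ(T)} · Λ₀'(T) ) ] = a'(T)·e^{2κ(T)} + 2·a(T)·b(T)·e^{2κ(T)} − e^{2κ(T)}·σ(T)². -/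
/-- The integrand `p v * (g T - g v) - q v * (g T - g v) ^ 2 / 2` vanishes at `v = T`, so its integral
over `[0, T]` is differentiated in `T` without a boundary term. -/
theorem hasDerivAt_integral_linear_sub_quadratic {p q g : ℝ → ℝ} {g' T : ℝ}
    (hp : Continuous p) (hq : Continuous q) (hg : Continuous g) (hgT : HasDerivAt g g' T) :
    HasDerivAt (fun T => ∫ v in (0:ℝ)..T, (p v * (g T - g v) - (1/2) * q v * (g T - g v) ^ 2))
      (g' * ((∫ v in (0:ℝ)..T, p v) - g T * (∫ v in (0:ℝ)..T, q v)
        + ∫ v in (0:ℝ)..T, q v * g v)) T := by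
  have expand : (fun T => ∫ v in (0:ℝ)..T, (p v * (g T - g v) - (1/2) * q v * (g T - g v) ^ 2))
      = fun T => g T * (∫ v in (0:ℝ)..T, p v) - (∫ v in (0:ℝ)..T, p v * g v)
        - (1/2) * g T ^ 2 * (∫ v in (0:ℝ)..T, q v) + g T * (∫ v in (0:ℝ)..T, q v * g v)
        - (1/2) * ∫ v in (0:ℝ)..T, q v * g v ^ 2 := by
    funext T
    have int {f : ℝ → ℝ} (hf : Continuous f) : IntervalIntegrable f MeasureTheory.volume 0 T :=
      hf.intervalIntegrable _ _
    simp only [← intervalIntegral.integral_const_mul]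
    rw [← intervalIntegral.integral_sub (int (by fun_prop)) (int (by fun_prop)),
      ← intervalIntegral.integral_sub (int (by fun_prop)) (int (by fun_prop)),
      ← intervalIntegral.integral_add (int (by fun_prop)) (int (by fun_prop)),
      ← intervalIntegral.integral_sub (int (by fun_prop)) (int (by fun_prop))]
    congr 1
    funext v
    ring
  have ftc {f : ℝ → ℝ} (hf : Continuous f) :
      HasDerivAt (fun T => ∫ v in (0:ℝ)..T, f v) (f T) T :=
    (hf.integral_hasStrictDerivAt 0 T).hasDerivAt
  rw [expand]
  refine (((((hgT.mul (ftc hp)).sub (ftc (hp.mul hg))).sub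
    (((hgT.pow 2).const_mul (1/2)).mul (ftc hq))).add (hgT.mul (ftc (hq.mul hg)))).sub
    ((ftc (hq.mul (hg.pow 2))).const_mul (1/2))).congr_deriv ?_
  simp only [Pi.mul_apply, Pi.pow_apply]
  ring


/-- Third derivative identity in the Hull-White calibration:
`d/dT [ e^{κ(T)} d/dT ( e^{κ(T)} Λ₀'(T) ) ] = a'(T)e^{2κ(T)} + 2a(T)b(T)e^{2κ(T)} − e^{2κ(T)}σ(T)²`. -/
theorem hull_white_calibration_third_derivative
    (a b σ : ℝ → ℝ) (ha : ContDiff ℝ 1 a) (hb : Continuous b) (hσ : Continuous σ)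
    (κ Λ₀ : ℝ → ℝ)
    (hκ : ∀ t, κ t = ∫ s in (0:ℝ)..t, b s)
    (hΛ : ∀ T, Λ₀ T = ∫ v in (0:ℝ)..T,
      (Real.exp (κ v) * a v * (∫ z in v..T, Real.exp (-κ z))
        - (1/2) * Real.exp (2 * κ v) * σ v ^ 2 * (∫ z in v..T, Real.exp (-κ z)) ^ 2)) :
    ∀ T, deriv (fun T₁ => Real.exp (κ T₁)
          * deriv (fun T₂ => Real.exp (κ T₂) * deriv Λ₀ T₂) T₁) T
      = deriv a T * Real.exp (2 * κ T) + 2 * a T * b T * Real.exp (2 * κ T)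
        - Real.exp (2 * κ T) * σ T ^ 2 := by
  have ftc {f : ℝ → ℝ} (hf : Continuous f) (T : ℝ) :
      HasDerivAt (fun T => ∫ v in (0:ℝ)..T, f v) (f T) T :=
    (hf.integral_hasStrictDerivAt 0 T).hasDerivAt
  have hκ' (T : ℝ) : HasDerivAt κ (b T) T := by
    rw [funext hκ]
    exact ftc hb T
  have κ_cont : Continuous κ := continuous_iff_continuousAt.2 fun T => (hκ' T).continuousAt
  have a_cont : Continuous a := ha.continuous
  have E_cont : Continuous fun z => Real.exp (-κ z) := by fun_prop
  have exp_mul_exp_neg (T : ℝ) : Real.exp (κ T) * Real.exp (-κ T) = 1 := by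
    rw [← Real.exp_add, add_neg_cancel, Real.exp_zero]
  have exp_two (T : ℝ) : Real.exp (2 * κ T) = Real.exp (κ T) * Real.exp (κ T) := by
    rw [← Real.exp_add, two_mul]
  set p : ℝ → ℝ := fun v => Real.exp (κ v) * a v with hp
  set q : ℝ → ℝ := fun v => Real.exp (2 * κ v) * σ v ^ 2 with hq
  set g : ℝ → ℝ := fun T => ∫ z in (0:ℝ)..T, Real.exp (-κ z) with hg
  have p_cont : Continuous p := by fun_prop
  have q_cont : Continuous q := by fun_prop
  have hg' (T : ℝ) : HasDerivAt g (Real.exp (-κ T)) T := ftc E_cont T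
  have g_cont : Continuous g := continuous_iff_continuousAt.2 fun T => (hg' T).continuousAt
  have hΛ₀ : Λ₀ = fun T => ∫ v in (0:ℝ)..T,
      (p v * (g T - g v) - (1/2) * q v * (g T - g v) ^ 2) := by
    funext T
    rw [hΛ]
    congr 1
    funext v
    rw [← intervalIntegral.integral_interval_sub_left (E_cont.intervalIntegrable 0 T)
      (E_cont.intervalIntegrable 0 v)]
    simp only [hp, hq, hg]
    ring
  have first : (fun T => Real.exp (κ T) * deriv Λ₀ T) = fun T =>
      (∫ v in (0:ℝ)..T, p v) - g T * (∫ v in (0:ℝ)..T, q v) + ∫ v in (0:ℝ)..T, q v * g v := by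
    funext T
    rw [hΛ₀, (hasDerivAt_integral_linear_sub_quadratic p_cont q_cont g_cont (hg' T)).deriv,
      ← mul_assoc, exp_mul_exp_neg, one_mul]
  have second : (fun T => Real.exp (κ T) * deriv (fun T => Real.exp (κ T) * deriv Λ₀ T) T) =
      fun T => Real.exp (2 * κ T) * a T - ∫ v in (0:ℝ)..T, q v := by
    funext T
    rw [first, (((ftc p_cont T).fun_sub ((hg' T).fun_mul (ftc q_cont T))).fun_add
      (ftc (q_cont.fun_mul g_cont) T)).deriv]
    simp only [hp, exp_two]
    linear_combination (-∫ v in (0:ℝ)..T, q v) * exp_mul_exp_neg T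
  intro T
  have ha' : HasDerivAt a (deriv a T) T := (ha.differentiable one_ne_zero T).hasDerivAt
  rw [second, ((((hκ' T).const_mul 2).exp.fun_mul ha').fun_sub (ftc q_cont T)).deriv]
  simp only [hq]
  ring
end
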